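/- arXiv:2403.16882 — 3 statements merged into one kernel-verified Lean document; each statement's English description precedes it below -/
import Mathlib

section
/- Entropy-conservation compatibility in the x-direction: for any functions ε, η : ℝ → ℝ, any constants k, m > 0, and any two states (ρ₋, vx₋, vy₋, T₋), (ρ₊, vx₊, vy₊, T₊) with ρ₋, ρ₊, T₋, T₊ > 0, ρ₋ ≠ ρ₊ and T₋ ≠ T₊, the numerical flux components F_ρ, F_ρvx, F_ρvy, F_E in the x-direction satisfy Tadmor's condition ⟦ω₁⟧·F_ρ + ⟦ω₂⟧·F_ρvx + ⟦ω₃⟧·F_ρvy + ⟦ω₄⟧·F_E = ⟦ψ_x⟧, where ψ_x := (k/m)·ρ·vx. -/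
/-- Jump `⟦a⟧ := a₊ − a₋`. -/
def jump (am ap : ℝ) : ℝ := ap - am

/-- Arithmetic mean `{{a}} := (a₋ + a₊)/2`. -/
noncomputable def avg (am ap : ℝ) : ℝ := (am + ap) / 2

/-- Geometric mean `{{a}}_geo := √(a₋·a₊)` (for `a₋, a₊ > 0`). -/
noncomputable def geoMean (am ap : ℝ) : ℝ := Real.sqrt (am * ap)

/-- Logarithmic mean `{{a}}_log := (a₊ − a₋)/(ln a₊ − ln a₋)` (for `a₋, a₊ > 0`,
`a₋ ≠ a₊`; when `a₋ = a₊ = a` it is taken to equal `a`). -/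
noncomputable def logMean (am ap : ℝ) : ℝ :=
  if am = ap then am else (ap - am) / (Real.log ap - Real.log am)

/-- Entropy-conservation compatibility of the numerical flux in the x-direction:
`⟦ω₁⟧·F_ρ + ⟦ω₂⟧·F_ρvx + ⟦ω₃⟧·F_ρvy + ⟦ω₄⟧·F_E = ⟦ψ_x⟧` with `ψ_x = (k/m)·ρ·vx`. -/
theorem ec_flux_compatibility_x (ε η : ℝ → ℝ) (k m : ℝ) (hk : 0 < k) (hm : 0 < m)
    (ρm ρp vxm vxp vym vyp Tm Tp : ℝ)
    (hρm : 0 < ρm) (hρp : 0 < ρp) (hTm : 0 < Tm) (hTp : 0 < Tp)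
    (hρ : ρm ≠ ρp) (hT : Tm ≠ Tp) :
    let Frho : ℝ := logMean ρm ρp * avg vxm vxp
    let Frvx : ℝ := Frho * avg vxm vxp + (k / m) * avg ρm ρp / avg (1 / Tm) (1 / Tp)
    let Frvy : ℝ := Frho * avg vym vyp
    let FE : ℝ :=
      Frho * geoMean Tm Tp ^ 2 *
          (jump (η Tm) (η Tp) / jump Tm Tp -
            avg (1 / Tm) (1 / Tp) * jump (ε Tm) (ε Tp) / jump Tm Tp) +
        Frho * (avg (ε Tm) (ε Tp) - (avg (vxm ^ 2) (vxp ^ 2) + avg (vym ^ 2) (vyp ^ 2)) / 2) +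
        avg vxm vxp * Frvx + avg vym vyp * Frvy
    let ω1m : ℝ := -η Tm + (k / m) * Real.log ρm + (ε Tm - (vxm ^ 2 + vym ^ 2) / 2) / Tm
    let ω1p : ℝ := -η Tp + (k / m) * Real.log ρp + (ε Tp - (vxp ^ 2 + vyp ^ 2) / 2) / Tp
    jump ω1m ω1p * Frho + jump (vxm / Tm) (vxp / Tp) * Frvx +
        jump (vym / Tm) (vyp / Tp) * Frvy + jump (-(1 / Tm)) (-(1 / Tp)) * FE =
      jump ((k / m) * ρm * vxm) ((k / m) * ρp * vxp) := by
  intro Frho Frvx Frvy FE ω1m ω1p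
  have hL : logMean ρm ρp * (Real.log ρp - Real.log ρm) = ρp - ρm := by
    have h : Real.log ρp - Real.log ρm ≠ 0 := by
      intro h
      exact hρ (Real.log_injOn_pos hρm hρp (by linarith))
    rw [logMean, if_neg hρ, div_mul_cancel₀ _ h]
  have hG : geoMean Tm Tp ^ 2 = Tm * Tp := Real.sq_sqrt (mul_pos hTm hTp).le
  have hD : Tp - Tm ≠ 0 := sub_ne_zero.mpr (Ne.symm hT)
  have hP : (k / m * avg ρm ρp / avg (1 / Tm) (1 / Tp)) * ((1 / Tm + 1 / Tp) / 2)
      = k / m * ((ρm + ρp) / 2) := by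
    have h : (1 / Tm + 1 / Tp) / 2 ≠ 0 := by positivity
    simp only [avg]
    exact div_mul_cancel₀ _ h
  have hX : (1 / Tm - 1 / Tp) * (Tm * Tp) * (Tp - Tm)⁻¹ = 1 := by
    field_simp
  simp only [Frho, Frvx, Frvy, FE, ω1m, ω1p]
  rw [hG]
  generalize k / m * avg ρm ρp / avg (1 / Tm) (1 / Tp) = P at *
  generalize logMean ρm ρp = L at *
  simp only [jump, avg, div_eq_mul_inv, one_mul] at *
  generalize Tm * Tp = Q at *
  generalize (Tp - Tm)⁻¹ = R at *
  generalize Tm⁻¹ = a at *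
  generalize Tp⁻¹ = b at *
  linear_combination (k * m⁻¹ * ((vxm + vxp) / 2)) * hL + (vxp - vxm) * hP +
    L * ((vxm + vxp) / 2) * ((η Tp - η Tm) - (a + b) / 2 * (ε Tp - ε Tm)) * hX
end

section
/- Entropy-conservation compatibility in the y-direction: for any functions ε, η : ℝ → ℝ, any constants k, m > 0, and any two states (ρ₋, vx₋, vy₋, T₋), (ρ₊, vx₊, vy₊, T₊) with ρ₋, ρ₊, T₋, T₊ > 0, ρ₋ ≠ ρ₊ and T₋ ≠ T₊, the numerical flux components G_ρ, G_ρvx, G_ρvy, G_E in the y-direction satisfy Tadmor's condition ⟦ω₁⟧·G_ρ + ⟦ω₂⟧·G_ρvx + ⟦ω₃⟧·G_ρvy + ⟦ω₄⟧·G_E = ⟦ψ_y⟧, where ψ_y := (k/m)·ρ·vy. -/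
/-- Entropy-conservation compatibility of the numerical flux in the y-direction:
`⟦ω₁⟧·G_ρ + ⟦ω₂⟧·G_ρvx + ⟦ω₃⟧·G_ρvy + ⟦ω₄⟧·G_E = ⟦ψ_y⟧` with `ψ_y = (k/m)·ρ·vy`. -/
theorem ec_flux_compatibility_y (ε η : ℝ → ℝ) (k m : ℝ) (hk : 0 < k) (hm : 0 < m)
    (ρm ρp vxm vxp vym vyp Tm Tp : ℝ)
    (hρm : 0 < ρm) (hρp : 0 < ρp) (hTm : 0 < Tm) (hTp : 0 < Tp)
    (hρ : ρm ≠ ρp) (hT : Tm ≠ Tp) :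
    let Grho : ℝ := logMean ρm ρp * avg vym vyp
    let Grvx : ℝ := Grho * avg vxm vxp
    let Grvy : ℝ := Grho * avg vym vyp + (k / m) * avg ρm ρp / avg (1 / Tm) (1 / Tp)
    let GE : ℝ :=
      Grho * geoMean Tm Tp ^ 2 *
          (jump (η Tm) (η Tp) / jump Tm Tp -
            avg (1 / Tm) (1 / Tp) * jump (ε Tm) (ε Tp) / jump Tm Tp) +
        Grho * (avg (ε Tm) (ε Tp) - (avg (vxm ^ 2) (vxp ^ 2) + avg (vym ^ 2) (vyp ^ 2)) / 2) +
        avg vxm vxp * Grvx + avg vym vyp * Grvy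
    let ω1m : ℝ := -η Tm + (k / m) * Real.log ρm + (ε Tm - (vxm ^ 2 + vym ^ 2) / 2) / Tm
    let ω1p : ℝ := -η Tp + (k / m) * Real.log ρp + (ε Tp - (vxp ^ 2 + vyp ^ 2) / 2) / Tp
    jump ω1m ω1p * Grho + jump (vxm / Tm) (vxp / Tp) * Grvx +
        jump (vym / Tm) (vyp / Tp) * Grvy + jump (-(1 / Tm)) (-(1 / Tp)) * GE =
      jump ((k / m) * ρm * vym) ((k / m) * ρp * vyp) := by
  intro Grho Grvx Grvy GE ω1m ω1p
  have hTd : Tp - Tm ≠ 0 := sub_ne_zero.mpr hT.symm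
  have hlog : Real.log ρp - Real.log ρm ≠ 0 := by
    intro h
    exact hρ (Real.log_injOn_pos hρm hρp (by linarith))
  have h1 : (Real.log ρp - Real.log ρm) * logMean ρm ρp = ρp - ρm := by
    unfold logMean
    rw [if_neg hρ]
    field_simp
  have hA : avg (1 / Tm) (1 / Tp) ≠ 0 := by
    unfold avg
    positivity
  have h2 : (k / m) * avg ρm ρp / avg (1 / Tm) (1 / Tp) * avg (1 / Tm) (1 / Tp)
      = (k / m) * avg ρm ρp := div_mul_cancel₀ _ hA
  have h3 : (1 / Tm - 1 / Tp) * (geoMean Tm Tp ^ 2 *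
      (jump (η Tm) (η Tp) / jump Tm Tp -
            avg (1 / Tm) (1 / Tp) * jump (ε Tm) (ε Tp) / jump Tm Tp))
      = jump (η Tm) (η Tp) - avg (1 / Tm) (1 / Tp) * jump (ε Tm) (ε Tp) := by
    have hg : geoMean Tm Tp ^ 2 = Tm * Tp := Real.sq_sqrt (by positivity)
    rw [hg]
    generalize avg (1 / Tm) (1 / Tp) = A
    simp only [jump]
    field_simp
  simp only [Grho, Grvx, Grvy, GE, ω1m, ω1p]
  generalize (jump (η Tm) (η Tp) / jump Tm Tp -
            avg (1 / Tm) (1 / Tp) * jump (ε Tm) (ε Tp) / jump Tm Tp) = Q at *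
  generalize (k / m) * avg ρm ρp / avg (1 / Tm) (1 / Tp) = q at *
  generalize k / m = P at *
  generalize logMean ρm ρp = L at *
  generalize geoMean Tm Tp = g at *
  simp only [jump, avg, one_div, div_eq_mul_inv] at h1 h2 h3 ⊢
  linear_combination (P * (vym + vyp) / 2) * h1 + (vyp - vym) * h2
    + (L * (vym + vyp) / 2) * h3
end

section
/- Inverse-function error bound for interpolation (Lemma 1): let f : ℝ → ℝ be differentiable with f′(x) ≥ A for all x, where A > 0 is a constant, and let p : ℝ → ℝ satisfy |f(x) − p(x)| ≤ C₁·h^n for all x, where C₁ ≥ 0, h > 0 and n ∈ ℕ. If x₀ and x̃₀ are reals such that p(x̃₀) = f(x₀), then |x̃₀ − x₀| ≤ (C₁/A)·h^n. -/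
/-- Inverse-function error bound for interpolation: if `f` is differentiable with
`f′ ≥ A > 0` everywhere, `p` approximates `f` with pointwise error at most `C₁·h^n`,
and `p(xt₀) = f(x₀)`, then `|xt₀ − x₀| ≤ (C₁/A)·h^n`. -/
theorem inverse_interpolation_error (f p : ℝ → ℝ) (A C₁ h : ℝ) (n : ℕ)
    (hf : Differentiable ℝ f) (hA : 0 < A) (hderiv : ∀ x : ℝ, A ≤ deriv f x)
    (hC₁ : 0 ≤ C₁) (hh : 0 < h) (happrox : ∀ x : ℝ, |f x - p x| ≤ C₁ * h ^ n)
    (x₀ xt₀ : ℝ) (hinv : p xt₀ = f x₀) :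
    |xt₀ - x₀| ≤ (C₁ / A) * h ^ n := by
  have h1 := abs_le.mp (happrox xt₀)
  rw [hinv] at h1
  rw [div_mul_eq_mul_div, le_div_iff₀ hA]
  rcases le_total x₀ xt₀ with hx | hx
  · have h2 := mul_sub_le_image_sub_of_le_deriv hf hderiv hx
    rw [abs_of_nonneg (sub_nonneg.mpr hx)]
    linarith [h1.2]
  · have h2 := mul_sub_le_image_sub_of_le_deriv hf hderiv hx
    rw [abs_of_nonpos (sub_nonpos.mpr hx)]
    linarith [h1.1]
end
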